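/- There exist absolute constants C_T ≥ 1 and C_d ≥ 1 (the paper's proof takes C_T = 20 and C_d = 54) such that the following holds. Let M ∈ ℝ^{m×n} be a rank-r μ-incoherent matrix with singular values Σmax ≥ Σmin > 0, and set β_T = √(C_T·r·Σmax). Suppose X ∈ ℝ^{m×r} and Y ∈ ℝ^{n×r} satisfy d := ‖M − X·Yᵀ‖_F ≤ Σmin/(C_d·r), √(2/3)·β_T ≤ ‖X‖_F ≤ β_T and √(2/3)·β_T ≤ ‖Y‖_F ≤ β_T. Then there exist U ∈ ℝ^{m×r} and V ∈ ℝ^{n×r} such that: (i) U·Vᵀ = M; (ii) ‖U‖_F ≤ ‖X‖_F and ‖V‖_F ≤ ‖Y‖_F; (iii) ‖U − X‖_F·‖V − Y‖_F ≤ 25·√r·(β_T²/Σmin²)·d²; (iv) ‖U^{(i)}‖² ≤ (rμ/m)·β_T² for every row i and ‖V^{(j)}‖² ≤ (rμ/n)·β_T² for every row j. -/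

import Mathlib

open Matrix
open scoped Classical

noncomputable section

/-- Frobenius norm of a real matrix. -/
def frob {m n : ℕ} (A : Matrix (Fin m) (Fin n) ℝ) : ℝ :=
  Real.sqrt (∑ i, ∑ j, A i j ^ 2)

/-- Euclidean norm of the `i`-th row of a matrix. -/
def rowNorm {m n : ℕ} (A : Matrix (Fin m) (Fin n) ℝ) (i : Fin m) : ℝ :=
  Real.sqrt (∑ j, A i j ^ 2)

/-- Frobenius inner product `⟨A,B⟩ = trace(AᵀB)`. -/
def finner {m n : ℕ} (A B : Matrix (Fin m) (Fin n) ℝ) : ℝ :=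
  ∑ i, ∑ j, A i j * B i j

/-- Projection onto the set of entries indexed by `Ω` (other entries are set to `0`). -/
def projOmega {m n : ℕ} (Ω : Finset (Fin m × Fin n)) (A : Matrix (Fin m) (Fin n) ℝ) :
    Matrix (Fin m) (Fin n) ℝ :=
  Matrix.of fun i j => if (i, j) ∈ Ω then A i j else 0

/-- `G₀(z) = (max{0, z-1})²`. -/
def G0 (z : ℝ) : ℝ := max 0 (z - 1) ^ 2

/-- `G₀′(z) = 2·max{0, z-1}`. -/
def G0' (z : ℝ) : ℝ := 2 * max 0 (z - 1)

/-- The matrix whose `i`-th row is the `i`-th row of `A` and whose other rows vanish. -/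
def rowMat {m n : ℕ} (A : Matrix (Fin m) (Fin n) ℝ) (i : Fin m) :
    Matrix (Fin m) (Fin n) ℝ :=
  Matrix.of fun i' j => if i' = i then A i j else 0

/-- The regularizer `G(X,Y)`. -/
def Greg {m n r : ℕ} (ρ β1 β2 βT : ℝ) (X : Matrix (Fin m) (Fin r) ℝ)
    (Y : Matrix (Fin n) (Fin r) ℝ) : ℝ :=
  ρ * ∑ i, G0 (3 * rowNorm X i ^ 2 / (2 * β1 ^ 2)) +
    ρ * ∑ j, G0 (3 * rowNorm Y j ^ 2 / (2 * β2 ^ 2)) +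
    ρ * G0 (3 * frob X ^ 2 / (2 * βT ^ 2)) +
    ρ * G0 (3 * frob Y ^ 2 / (2 * βT ^ 2))

/-- The regularized objective `F̃(X,Y)`. -/
def Ftilde {m n r : ℕ} (Ω : Finset (Fin m × Fin n)) (M : Matrix (Fin m) (Fin n) ℝ)
    (ρ β1 β2 βT : ℝ) (X : Matrix (Fin m) (Fin r) ℝ) (Y : Matrix (Fin n) (Fin r) ℝ) : ℝ :=
  (1 / 2) * frob (projOmega Ω (M - X * Yᵀ)) ^ 2 + Greg ρ β1 β2 βT X Y

/-- Gradient of the regularizer with respect to one of the factors. -/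
def gradG1 {m r : ℕ} (ρ β βT : ℝ) (X : Matrix (Fin m) (Fin r) ℝ) :
    Matrix (Fin m) (Fin r) ℝ :=
  (∑ i, (ρ * G0' (3 * rowNorm X i ^ 2 / (2 * β ^ 2)) * (3 / β ^ 2)) • rowMat X i) +
    (ρ * G0' (3 * frob X ^ 2 / (2 * βT ^ 2)) * (3 / βT ^ 2)) • X

/-- `∇_X F̃(X,Y)`. -/
def gradX {m n r : ℕ} (Ω : Finset (Fin m × Fin n)) (M : Matrix (Fin m) (Fin n) ℝ)
    (ρ β1 βT : ℝ) (X : Matrix (Fin m) (Fin r) ℝ) (Y : Matrix (Fin n) (Fin r) ℝ) :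
    Matrix (Fin m) (Fin r) ℝ :=
  projOmega Ω (X * Yᵀ - M) * Y + gradG1 ρ β1 βT X

/-- `∇_Y F̃(X,Y)`. -/
def gradY {m n r : ℕ} (Ω : Finset (Fin m × Fin n)) (M : Matrix (Fin m) (Fin n) ℝ)
    (ρ β2 βT : ℝ) (X : Matrix (Fin m) (Fin r) ℝ) (Y : Matrix (Fin n) (Fin r) ℝ) :
    Matrix (Fin n) (Fin r) ℝ :=
  (projOmega Ω (X * Yᵀ - M))ᵀ * X + gradG1 ρ β2 βT Y

/-- Membership in `K₁`. -/
def K1mem {m n r : ℕ} (β1 β2 : ℝ) (X : Matrix (Fin m) (Fin r) ℝ)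
    (Y : Matrix (Fin n) (Fin r) ℝ) : Prop :=
  (∀ i, rowNorm X i ≤ β1) ∧ ∀ j, rowNorm Y j ≤ β2

/-- Membership in `K₂`. -/
def K2mem {m n r : ℕ} (βT : ℝ) (X : Matrix (Fin m) (Fin r) ℝ)
    (Y : Matrix (Fin n) (Fin r) ℝ) : Prop :=
  frob X ≤ βT ∧ frob Y ≤ βT

/-- Membership in `K(t) = {(X,Y) : ‖M - XYᵀ‖_F ≤ t}`. -/
def Kmem {m n r : ℕ} (M : Matrix (Fin m) (Fin n) ℝ) (t : ℝ)
    (X : Matrix (Fin m) (Fin r) ℝ) (Y : Matrix (Fin n) (Fin r) ℝ) : Prop :=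
  frob (M - X * Yᵀ) ≤ t

/-! helper lemmas -/

section Helpers
open scoped Matrix.Norms.Frobenius

lemma frob_eq {m n : ℕ} (A : Matrix (Fin m) (Fin n) ℝ) : frob A = ‖A‖ := by
  rw [Matrix.frobenius_norm_def, frob, Real.sqrt_eq_rpow]
  simp

lemma frob_add_le {m n : ℕ} (A B : Matrix (Fin m) (Fin n) ℝ) :
    frob (A + B) ≤ frob A + frob B := by
  simp only [frob_eq]; exact norm_add_le _ _

lemma frob_mul_le {m n k : ℕ} (A : Matrix (Fin m) (Fin n) ℝ) (B : Matrix (Fin n) (Fin k) ℝ) :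
    frob (A * B) ≤ frob A * frob B := by
  simp only [frob_eq]; exact Matrix.frobenius_norm_mul _ _

lemma frob_smul {m n : ℕ} (c : ℝ) (A : Matrix (Fin m) (Fin n) ℝ) :
    frob (c • A) = |c| * frob A := by
  simp only [frob_eq]; rw [norm_smul, Real.norm_eq_abs]

lemma frob_transpose {m n : ℕ} (A : Matrix (Fin m) (Fin n) ℝ) : frob Aᵀ = frob A := by
  simp only [frob_eq]; exact Matrix.frobenius_norm_transpose _

lemma frob_neg {m n : ℕ} (A : Matrix (Fin m) (Fin n) ℝ) : frob (-A) = frob A := by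
  simp only [frob_eq]; exact norm_neg _

lemma frob_sub_comm {m n : ℕ} (A B : Matrix (Fin m) (Fin n) ℝ) :
    frob (A - B) = frob (B - A) := by
  simp only [frob_eq]; exact norm_sub_rev _ _

lemma frob_zero_iff {m n : ℕ} (A : Matrix (Fin m) (Fin n) ℝ) : frob A = 0 ↔ A = 0 := by
  simp only [frob_eq]; exact norm_eq_zero

end Helpers

lemma frob_nonneg {m n : ℕ} (A : Matrix (Fin m) (Fin n) ℝ) : 0 ≤ frob A := Real.sqrt_nonneg _

lemma frob_sq {m n : ℕ} (A : Matrix (Fin m) (Fin n) ℝ) :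
    frob A ^ 2 = ∑ i, ∑ j, A i j ^ 2 := by
  rw [frob, Real.sq_sqrt]; positivity

lemma frob_sq_trace {m n : ℕ} (A : Matrix (Fin m) (Fin n) ℝ) :
    frob A ^ 2 = (Aᵀ * A).trace := by
  rw [frob_sq, Finset.sum_comm]
  simp [Matrix.trace, Matrix.mul_apply, pow_two]

lemma rowNorm_mul_sq {m r s : ℕ} (A : Matrix (Fin m) (Fin r) ℝ) (B : Matrix (Fin r) (Fin s) ℝ)
    (i : Fin m) : rowNorm (A * B) i ^ 2 ≤ (∑ k, A i k ^ 2) * frob B ^ 2 := by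
  rw [rowNorm, Real.sq_sqrt (by positivity), frob_sq, Finset.sum_comm, Finset.mul_sum]
  refine Finset.sum_le_sum fun j _ => ?_
  rw [Matrix.mul_apply]
  exact Finset.sum_mul_sq_le_sq_mul_sq _ _ _

lemma frob_iso {m r s : ℕ} (P : Matrix (Fin m) (Fin r) ℝ) (hP : Pᵀ * P = 1)
    (A : Matrix (Fin r) (Fin s) ℝ) : frob (P * A) = frob A := by
  have : frob (P * A) ^ 2 = frob A ^ 2 := by
    rw [frob_sq_trace, frob_sq_trace, Matrix.transpose_mul, Matrix.mul_assoc,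
      ← Matrix.mul_assoc Pᵀ, hP, Matrix.one_mul]
  exact (pow_left_inj₀ (frob_nonneg _) (frob_nonneg _) two_ne_zero).1 this

lemma frob_pyth {m r s : ℕ} (P : Matrix (Fin m) (Fin r) ℝ) (hP : Pᵀ * P = 1)
    (E : Matrix (Fin m) (Fin s) ℝ) :
    frob E ^ 2 = frob (Pᵀ * E) ^ 2 + frob (E - P * (Pᵀ * E)) ^ 2 := by
  have h : (E - P * (Pᵀ * E))ᵀ * (E - P * (Pᵀ * E)) = Eᵀ * E - (Pᵀ * E)ᵀ * (Pᵀ * E) := by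
    have h1 : Pᵀ * (P * (Pᵀ * E)) = Pᵀ * E := by
      rw [← Matrix.mul_assoc, hP, Matrix.one_mul]
    simp only [Matrix.transpose_sub, Matrix.transpose_mul, Matrix.transpose_transpose,
      Matrix.sub_mul, Matrix.mul_sub, Matrix.mul_assoc, h1]
    abel
  rw [frob_sq_trace, frob_sq_trace, frob_sq_trace, h, Matrix.trace_sub]
  ring

lemma frob_proj_le {m r s : ℕ} (P : Matrix (Fin m) (Fin r) ℝ) (hP : Pᵀ * P = 1)
    (E : Matrix (Fin m) (Fin s) ℝ) : frob (Pᵀ * E) ≤ frob E := by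
  have := frob_pyth P hP E
  exact (pow_le_pow_iff_left₀ (frob_nonneg _) (frob_nonneg _) two_ne_zero).1
    (by nlinarith [sq_nonneg (frob (E - P * (Pᵀ * E)))])

lemma frob_coproj_le {m r s : ℕ} (P : Matrix (Fin m) (Fin r) ℝ) (hP : Pᵀ * P = 1)
    (E : Matrix (Fin m) (Fin s) ℝ) : frob (E - P * (Pᵀ * E)) ≤ frob E := by
  have := frob_pyth P hP E
  exact (pow_le_pow_iff_left₀ (frob_nonneg _) (frob_nonneg _) two_ne_zero).1
    (by nlinarith [sq_nonneg (frob (Pᵀ * E))])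

lemma frob_diag_le {r s : ℕ} (σ : Fin r → ℝ) (S : ℝ) (h0 : ∀ k, 0 < σ k) (h : ∀ k, σ k ≤ S)
    (hS : 0 ≤ S) (W : Matrix (Fin r) (Fin s) ℝ) :
    frob (Matrix.diagonal σ * W) ≤ S * frob W := by
  refine (pow_le_pow_iff_left₀ (frob_nonneg _) (mul_nonneg hS (frob_nonneg _)) two_ne_zero).1 ?_
  rw [mul_pow, frob_sq, frob_sq, Finset.mul_sum]
  refine Finset.sum_le_sum fun i _ => ?_
  rw [Finset.mul_sum]
  refine Finset.sum_le_sum fun j _ => ?_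
  rw [Matrix.diagonal_mul, mul_pow]
  have := h0 i; have := h i
  gcongr

lemma le_frob_diag {r s : ℕ} (σ : Fin r → ℝ) (S : ℝ) (h : ∀ k, S ≤ σ k)
    (hS : 0 ≤ S) (W : Matrix (Fin r) (Fin s) ℝ) :
    S * frob W ≤ frob (Matrix.diagonal σ * W) := by
  refine (pow_le_pow_iff_left₀ (mul_nonneg hS (frob_nonneg _)) (frob_nonneg _) two_ne_zero).1 ?_
  rw [mul_pow, frob_sq, frob_sq, Finset.mul_sum]
  refine Finset.sum_le_sum fun i _ => ?_
  rw [Finset.mul_sum]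
  refine Finset.sum_le_sum fun j _ => ?_
  rw [Matrix.diagonal_mul, mul_pow]
  have := h i
  gcongr

lemma isUnit_of_inj {r : ℕ} (K : Matrix (Fin r) (Fin r) ℝ)
    (h : ∀ Z : Matrix (Fin r) (Fin r) ℝ, K * Z = 0 → Z = 0) : IsUnit K.det := by
  rw [isUnit_iff_ne_zero]
  intro hd
  obtain ⟨v, hv, hKv⟩ := Matrix.exists_mulVec_eq_zero_iff.2 hd
  obtain ⟨i, hi⟩ := Function.ne_iff.1 hv
  have := h (Matrix.of fun a _ => v a) (by
    ext a b
    have := congrFun hKv a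
    simpa [Matrix.mul_apply, Matrix.mulVec, dotProduct] using this)
  exact hi (by simpa using congrFun (congrFun this i) i)

lemma frob_gram {n r : ℕ} (V : Matrix (Fin n) (Fin r) ℝ) :
    frob V ^ 4 ≤ r * frob (Vᵀ * V) ^ 2 := by
  have h1 : frob V ^ 2 = ∑ i, (Vᵀ * V) i i := by rw [frob_sq_trace]; rfl
  calc frob V ^ 4 = (∑ i, (Vᵀ * V) i i) ^ 2 := by rw [← h1]; ring
    _ ≤ (Finset.univ : Finset (Fin r)).card * ∑ i, (Vᵀ * V) i i ^ 2 :=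
        sq_sum_le_card_mul_sum_sq
    _ ≤ _ := by
      rw [frob_sq, Finset.card_univ, Fintype.card_fin]
      gcongr with i
      exact Finset.single_le_sum (f := fun j => (Vᵀ * V) i j ^ 2)
        (fun j _ => sq_nonneg _) (Finset.mem_univ i)

lemma frob_expand {n r : ℕ} (V : Matrix (Fin n) (Fin r) ℝ) (t : ℝ) :
    frob (V * (1 - t • (Vᵀ * V))) ^ 2 =
      frob V ^ 2 - 2 * t * frob (Vᵀ * V) ^ 2 + t ^ 2 * frob (V * (Vᵀ * V)) ^ 2 := by
  simp only [frob_sq_trace]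
  have : (V * (1 - t • (Vᵀ * V)))ᵀ * (V * (1 - t • (Vᵀ * V))) =
      Vᵀ * V - (2 * t) • ((Vᵀ * V)ᵀ * (Vᵀ * V)) +
        t ^ 2 • ((V * (Vᵀ * V))ᵀ * (V * (Vᵀ * V))) := by
    simp only [Matrix.mul_sub, Matrix.mul_one, Matrix.mul_smul, Matrix.transpose_sub,
      Matrix.transpose_smul, Matrix.transpose_mul, Matrix.transpose_transpose, Matrix.sub_mul,
      Matrix.smul_mul, Matrix.mul_assoc]
    module
  rw [this, Matrix.trace_add, Matrix.trace_sub, Matrix.trace_smul, Matrix.trace_smul]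
  simp

set_option maxHeartbeats 2000000 in
lemma adjust {m n r : ℕ} (hr : 1 ≤ r) (U0 : Matrix (Fin m) (Fin r) ℝ)
    (V0 : Matrix (Fin n) (Fin r) ℝ) (S β η a b : ℝ) (hS : 0 < S) (hβ : 0 < β)
    (hβS : β ^ 2 = 100 * r * S) (hη0 : 0 ≤ η) (hη : η * r ≤ 0.0102 * β)
    (hM : ∀ W : Matrix (Fin n) (Fin r) ℝ, frob (U0 * V0ᵀ * W) ≤ S * frob W)
    (ha : 0.8 * β ≤ a) (hUa : frob U0 ≤ a) (hb : 0.8 * β ≤ b) (hbβ : b ≤ β)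
    (hV1 : b - η ≤ frob V0) (hV2 : frob V0 ≤ b + η) :
    ∃ N N' : Matrix (Fin r) (Fin r) ℝ, N * N'ᵀ = 1 ∧ frob (U0 * N) ≤ a ∧
      frob (V0 * N') ≤ b ∧ frob (U0 * N - U0) ≤ 0.1 * η ∧
      frob (V0 * N' - V0) ≤ 2.1 * Real.sqrt r * η := by
  set v := frob V0 with hv
  set H := V0ᵀ * V0 with hH
  set h := frob H with hh
  set q := Real.sqrt r with hq
  have hr' : (1 : ℝ) ≤ r := by exact_mod_cast hr
  have hq2 : q ^ 2 = r := Real.sq_sqrt (by positivity)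
  have hq1 : 1 ≤ q := Real.one_le_sqrt.2 hr'
  have hqr : q ≤ r := by nlinarith
  have hηβ : η ≤ 0.0102 * β := by nlinarith
  have hvl : 0.78 * β ≤ v := by linarith
  have hvpos : 0 < v := by nlinarith
  have hg : v ^ 4 ≤ r * h ^ 2 := frob_gram V0
  have hh0 : 0 ≤ h := frob_nonneg _
  have hgq : v ^ 2 ≤ q * h := by
    refine (pow_le_pow_iff_left₀ (by positivity) (by positivity) two_ne_zero).1 ?_
    rw [mul_pow, hq2]; linarith [hg]
  have hhpos : 0 < h := by
    rcases hh0.eq_or_lt with h0 | h0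
    · rw [← h0] at hgq; nlinarith [pow_pos hvpos 2]
    · exact h0
  set τ := 2 * η * v / h ^ 2 with hτ
  have hτ0 : 0 ≤ τ := by positivity
  have hτh2 : τ * h ^ 2 = 2 * η * v := by rw [hτ]; field_simp
  -- τ h ≤ 1/4
  have hτh : τ * h ≤ 1 / 4 := by
    have : τ * h = 2 * η * v / h := by rw [hτ]; field_simp
    rw [this, div_le_iff₀ hhpos]
    have h1 : 8 * η * q ≤ v := by nlinarith
    have h2 : 8 * η * q * v ≤ q * h := by nlinarith
    have h3 : q * (8 * η * v) ≤ q * h := by linarith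
    have := le_of_mul_le_mul_left h3 (by positivity)
    linarith
  have hτvh : τ * (v * h) ≤ 2 * q * η := by
    have : τ * (v * h) = 2 * η * v ^ 2 / h := by rw [hτ]; field_simp
    rw [this, div_le_iff₀ hhpos]
    nlinarith
  have hHT : Hᵀ = H := by rw [hH]; simp
  set K := (1 : Matrix (Fin r) (Fin r) ℝ) - τ • H with hK
  have hKT : Kᵀ = K := by rw [hK]; simp [hHT]
  have hKu : IsUnit K.det := by
    apply isUnit_of_inj
    intro Z hZ
    have h1 : Z = τ • (H * Z) := by
      rw [hK, Matrix.sub_mul, Matrix.one_mul, Matrix.smul_mul] at hZ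
      exact sub_eq_zero.1 hZ
    have h2 : frob Z ≤ τ * (h * frob Z) := by
      calc frob Z = frob (τ • (H * Z)) := by rw [← h1]
        _ = τ * frob (H * Z) := by rw [frob_smul, abs_of_nonneg hτ0]
        _ ≤ _ := by gcongr; exact frob_mul_le _ _
    have := frob_nonneg Z
    rw [← frob_zero_iff]
    nlinarith
  have hK1 : K * K⁻¹ = 1 := Matrix.mul_nonsing_inv _ hKu
  have hK2 : K⁻¹ * K = 1 := Matrix.nonsing_inv_mul _ hKu
  have hKi : K⁻¹ = 1 + τ • (H * K⁻¹) := by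
    have : K * K⁻¹ = K⁻¹ - τ • (H * K⁻¹) := by
      conv_lhs => rw [hK, Matrix.sub_mul, Matrix.one_mul, Matrix.smul_mul]
    rw [hK1] at this
    rw [this]; abel
  have hKi' : K⁻¹ = 1 + τ • (K⁻¹ * H) := by
    have : K⁻¹ * K = K⁻¹ - τ • (K⁻¹ * H) := by
      conv_lhs => rw [hK, Matrix.mul_sub, Matrix.mul_one, Matrix.mul_smul]
    rw [hK2] at this
    rw [this]; abel
  -- V0 K⁻¹
  have hVK : frob (V0 * K⁻¹) ≤ 4 / 3 * v := by
    have h1 : V0 * K⁻¹ = V0 + τ • (V0 * K⁻¹ * H) := by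
      conv_lhs => rw [hKi', Matrix.mul_add, Matrix.mul_one, Matrix.mul_smul, ← Matrix.mul_assoc]
    have h2 : frob (V0 * K⁻¹) ≤ v + τ * (frob (V0 * K⁻¹) * h) := by
      calc frob (V0 * K⁻¹) = frob (V0 + τ • (V0 * K⁻¹ * H)) := by rw [← h1]
        _ ≤ v + frob (τ • (V0 * K⁻¹ * H)) := frob_add_le _ _
        _ = v + τ * frob (V0 * K⁻¹ * H) := by rw [frob_smul, abs_of_nonneg hτ0]
        _ ≤ _ := by gcongr; exact frob_mul_le _ _
    have := frob_nonneg (V0 * K⁻¹)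
    nlinarith
  set δ := 0.05 * η with hδ
  have hUK : frob (U0 * K⁻¹ - U0) ≤ δ := by
    have h1 : U0 * K⁻¹ - U0 = τ • (U0 * V0ᵀ * (V0 * K⁻¹)) := by
      conv_lhs => rw [hKi, Matrix.mul_add, Matrix.mul_one, Matrix.mul_smul]
      rw [add_sub_cancel_left, hH]; simp only [Matrix.mul_assoc]
    rw [h1, frob_smul, abs_of_nonneg hτ0]
    have h2 : τ * frob (U0 * V0ᵀ * (V0 * K⁻¹)) ≤ τ * (S * (4 / 3 * v)) := by
      gcongr
      exact (hM _).trans (by gcongr)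
    refine h2.trans ?_
    have : τ * (S * (4 / 3 * v)) = (8 / 3) * η * (v ^ 2 * S) / h ^ 2 := by
      rw [hτ]; field_simp; ring
    rw [this, div_le_iff₀ (by positivity), hδ]
    -- v^2 S ≤ h^2 /60
    have h3 : 60 * (v ^ 2 * S) ≤ h ^ 2 := by
      have e1 : 60 * (r * S) ≤ v ^ 2 := by nlinarith
      have e2 : v ^ 2 * (60 * (r * S)) ≤ v ^ 2 * v ^ 2 := by gcongr
      have e3 : (r : ℝ) * (60 * (v ^ 2 * S)) ≤ r * h ^ 2 := by nlinarith
      exact le_of_mul_le_mul_left e3 (by linarith)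
    have h4 := mul_le_mul_of_nonneg_left h3 hη0
    have h5 : 0 ≤ η * h ^ 2 := by positivity
    linarith
  have hVKb : frob (V0 * K) ≤ v - 1.8 * η := by
    have e := frob_expand V0 τ
    rw [← hH, ← hK] at e
    have h1 : frob (V0 * H) ≤ v * h := frob_mul_le _ _
    have h2 : τ ^ 2 * frob (V0 * H) ^ 2 ≤ (2 * q * η) ^ 2 := by
      rw [← mul_pow]
      have := frob_nonneg (V0 * H)
      refine pow_le_pow_left₀ (by positivity) ?_ 2
      exact (mul_le_mul_of_nonneg_left h1 hτ0).trans hτvh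
    refine (pow_le_pow_iff_left₀ (frob_nonneg _) (by linarith) two_ne_zero).1 ?_
    rw [e]
    have h3 : (2 * q * η) ^ 2 = 4 * (η * r) * η := by rw [← hq2]; ring
    have h4 : η * r * η ≤ 0.1 * v * η := by
      exact mul_le_mul_of_nonneg_right (by linarith) hη0
    change v ^ 2 - 2 * τ * h ^ 2 + _ ≤ _
    nlinarith
  have hVKd : frob (V0 * K - V0) ≤ 2 * q * η := by
    have : V0 * K - V0 = -(τ • (V0 * H)) := by
      rw [hK, Matrix.mul_sub, Matrix.mul_one, Matrix.mul_smul]; abel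
    rw [this, frob_neg, frob_smul, abs_of_nonneg hτ0]
    exact (mul_le_mul_of_nonneg_left (frob_mul_le _ _) hτ0).trans hτvh
  have hapos : 0 < a := by linarith
  have hδ0 : 0 ≤ δ := by positivity
  have hUK2 : frob (U0 * K⁻¹) ≤ a + δ := by
    have := frob_add_le U0 (U0 * K⁻¹ - U0)
    rw [add_sub_cancel] at this
    linarith
  have hc : 0 < a + δ := by linarith
  have hδa : δ / a * b ≤ 0.07 * η := by
    rw [div_mul_eq_mul_div, div_le_iff₀ hapos, hδ]
    nlinarith
  have hVKδ : δ / a * frob (V0 * K) ≤ 0.07 * η := by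
    refine le_trans ?_ hδa
    gcongr
    linarith
  refine ⟨(a / (a + δ)) • K⁻¹, (1 + δ / a) • K, ?_, ?_, ?_, ?_, ?_⟩
  · rw [Matrix.transpose_smul, hKT, Matrix.smul_mul, Matrix.mul_smul, hK2, smul_smul]
    have : a / (a + δ) * (1 + δ / a) = 1 := by field_simp
    rw [this, one_smul]
  · rw [Matrix.mul_smul, frob_smul, abs_of_nonneg (by positivity), div_mul_eq_mul_div,
      div_le_iff₀ hc]
    gcongr
  · rw [Matrix.mul_smul, frob_smul, abs_of_nonneg (by positivity)]
    linarith
  · have e : U0 * ((a / (a + δ)) • K⁻¹) - U0 =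
        (U0 * K⁻¹ - U0) + (-(δ / (a + δ))) • (U0 * K⁻¹) := by
      have : a / (a + δ) = 1 - δ / (a + δ) := by field_simp; ring
      rw [this, Matrix.mul_smul]; module
    rw [e]
    refine (frob_add_le _ _).trans ?_
    rw [frob_smul, abs_neg, abs_of_nonneg (by positivity)]
    have : δ / (a + δ) * frob (U0 * K⁻¹) ≤ δ := by
      rw [div_mul_eq_mul_div, div_le_iff₀ hc]
      gcongr
    linarith
  · have e : V0 * ((1 + δ / a) • K) - V0 = (V0 * K - V0) + (δ / a) • (V0 * K) := by
      rw [Matrix.mul_smul]; module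
    rw [e]
    refine (frob_add_le _ _).trans ?_
    rw [frob_smul, abs_of_nonneg (by positivity)]
    nlinarith

lemma core {r : ℕ} (X1 Y1 E : Matrix (Fin r) (Fin r) ℝ) (σ : Fin r → ℝ) (S β : ℝ)
    (hS : 0 < S) (hσ : ∀ k, S ≤ σ k) (h : X1 * Y1ᵀ = Matrix.diagonal σ - E)
    (hE : frob E ≤ 0.01 * S) (hY : frob Y1 ≤ β) :
    IsUnit X1.det ∧ ∀ (s : ℕ) (W : Matrix (Fin r) (Fin s) ℝ),
      0.99 * S * frob (X1⁻¹ * W) ≤ β * frob W := by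
  have key : ∀ (s : ℕ) (Z : Matrix (Fin r) (Fin s) ℝ),
      0.99 * S * frob Z ≤ frob (X1 * Y1ᵀ * Z) := by
    intro s Z
    have h1 := le_frob_diag σ S hσ hS.le Z
    have h2 : Matrix.diagonal σ * Z = X1 * Y1ᵀ * Z + E * Z := by
      rw [h, Matrix.sub_mul]; abel
    have h3 := frob_add_le (X1 * Y1ᵀ * Z) (E * Z)
    rw [← h2] at h3
    have h4 := frob_mul_le E Z
    have h5 : frob E * frob Z ≤ 0.01 * S * frob Z :=
      mul_le_mul_of_nonneg_right hE (frob_nonneg Z)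
    linarith
  have hu : IsUnit (X1 * Y1ᵀ).det := by
    apply isUnit_of_inj
    intro Z hZ
    have h1 := key r Z
    rw [hZ, (frob_zero_iff _).2 rfl] at h1
    rw [← frob_zero_iff]
    have := frob_nonneg Z
    by_contra hne
    have : 0 < frob Z := lt_of_le_of_ne this (Ne.symm hne)
    have : 0 < 0.99 * S * frob Z := by positivity
    linarith
  have hX : IsUnit X1.det := by
    rw [Matrix.det_mul] at hu
    exact isUnit_of_mul_isUnit_left hu
  refine ⟨hX, fun s W => ?_⟩
  have hk := key s ((X1 * Y1ᵀ)⁻¹ * W)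
  rw [← Matrix.mul_assoc, Matrix.mul_nonsing_inv _ hu, Matrix.one_mul] at hk
  have e : X1⁻¹ * W = Y1ᵀ * ((X1 * Y1ᵀ)⁻¹ * W) := by
    have : X1⁻¹ = Y1ᵀ * (X1 * Y1ᵀ)⁻¹ := by
      apply Matrix.inv_eq_right_inv
      rw [← Matrix.mul_assoc, Matrix.mul_nonsing_inv _ hu]
    rw [this, Matrix.mul_assoc]
  have h1 := frob_mul_le Y1ᵀ ((X1 * Y1ᵀ)⁻¹ * W)
  rw [← e, frob_transpose] at h1
  have h0 := frob_nonneg ((X1 * Y1ᵀ)⁻¹ * W)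
  have hβ : 0 ≤ β := (frob_nonneg _).trans hY
  calc 0.99 * S * frob (X1⁻¹ * W)
      ≤ 0.99 * S * (β * frob ((X1 * Y1ᵀ)⁻¹ * W)) := by
        gcongr
        exact h1.trans (by gcongr)
    _ = β * (0.99 * S * frob ((X1 * Y1ᵀ)⁻¹ * W)) := by ring
    _ ≤ β * frob W := by gcongr


set_option maxHeartbeats 2000000

/-- **Proposition 2.** -/
theorem stmt5 :
    ∃ CT Cd : ℝ, 1 ≤ CT ∧ 1 ≤ Cd ∧
      ∀ (m n r : ℕ), 1 ≤ m → 1 ≤ n → 1 ≤ r →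
      ∀ (μ Smax Smin : ℝ)
        (M : Matrix (Fin m) (Fin n) ℝ)
        (Uh : Matrix (Fin m) (Fin r) ℝ) (Vh : Matrix (Fin n) (Fin r) ℝ)
        (σ : Fin r → ℝ),
        Uhᵀ * Uh = 1 → Vhᵀ * Vh = 1 →
        (∀ k, 0 < σ k) → (∀ k l : Fin r, k ≤ l → σ l ≤ σ k) →
        M = Uh * Matrix.diagonal σ * Vhᵀ →
        ((∀ k, σ k ≤ Smax) ∧ ∃ k, σ k = Smax) →
        ((∀ k, Smin ≤ σ k) ∧ ∃ k, σ k = Smin) →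
        (∀ i, ∑ k, Uh i k ^ 2 ≤ μ * r / m) →
        (∀ j, ∑ k, Vh j k ^ 2 ≤ μ * r / n) →
        ∀ (X : Matrix (Fin m) (Fin r) ℝ) (Y : Matrix (Fin n) (Fin r) ℝ),
          frob (M - X * Yᵀ) ≤ Smin / (Cd * r) →
          Real.sqrt (2 / 3) * Real.sqrt (CT * r * Smax) ≤ frob X →
          frob X ≤ Real.sqrt (CT * r * Smax) →
          Real.sqrt (2 / 3) * Real.sqrt (CT * r * Smax) ≤ frob Y →
          frob Y ≤ Real.sqrt (CT * r * Smax) →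
          ∃ (U : Matrix (Fin m) (Fin r) ℝ) (V : Matrix (Fin n) (Fin r) ℝ),
            U * Vᵀ = M ∧
            frob U ≤ frob X ∧
            frob V ≤ frob Y ∧
            frob (U - X) * frob (V - Y) ≤
              25 * Real.sqrt r * (Real.sqrt (CT * r * Smax) ^ 2 / Smin ^ 2) *
                frob (M - X * Yᵀ) ^ 2 ∧
            (∀ i, rowNorm U i ^ 2 ≤ r * μ / m * Real.sqrt (CT * r * Smax) ^ 2) ∧
            (∀ j, rowNorm V j ^ 2 ≤ r * μ / n * Real.sqrt (CT * r * Smax) ^ 2) := by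
  refine ⟨100, 100, by norm_num, by norm_num, ?_⟩
  intro m n r hm hn hr μ Smax Smin M Uh Vh σ hU hV hσ0 _ hMeq hmax hmin hμU hμV X Y hd
    hX1 hX2 hY1 hY2
  obtain ⟨hmax, kmax, hkmax⟩ := hmax
  obtain ⟨hmin, kmin, hkmin⟩ := hmin
  have hSmin : 0 < Smin := hkmin ▸ hσ0 kmin
  have hSmax : 0 < Smax := hkmax ▸ hσ0 kmax
  have hr' : (1 : ℝ) ≤ r := by exact_mod_cast hr
  set β := Real.sqrt (100 * r * Smax) with hβdef
  have hβ2 : β ^ 2 = 100 * r * Smax := Real.sq_sqrt (by positivity)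
  have hβ : 0 < β := Real.sqrt_pos.2 (by positivity)
  have h23 : 0.8 ≤ Real.sqrt (2 / 3) := Real.le_sqrt_of_sq_le (by norm_num)
  have hXa : 0.8 * β ≤ frob X := le_trans (by gcongr) hX1
  have hYb : 0.8 * β ≤ frob Y := le_trans (by gcongr) hY1
  set E := M - X * Yᵀ with hE
  set d := frob E with hddef
  have hd0 : 0 ≤ d := frob_nonneg _
  have hdr : d * r ≤ 0.01 * Smin := by
    rw [le_div_iff₀ (by positivity)] at hd
    linarith
  have hd1 : d ≤ 0.01 * Smin := by nlinarith
  -- reduced matrices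
  have hPE : frob (Uhᵀ * E) ≤ d := frob_proj_le Uh hU E
  have hE' : frob (Uhᵀ * E * Vh) ≤ d := by
    have h1 := frob_proj_le Vh hV (Uhᵀ * E)ᵀ
    rw [← frob_transpose] at h1
    simp only [Matrix.transpose_mul, Matrix.transpose_transpose] at h1
    have h2 : frob (Eᵀ * Uh) = frob (Uhᵀ * E) := by
      rw [← frob_transpose]; simp
    rw [h2] at h1
    exact h1.trans hPE
  have hUM : Uhᵀ * M = Matrix.diagonal σ * Vhᵀ := by
    rw [hMeq, Matrix.mul_assoc, ← Matrix.mul_assoc, hU, Matrix.one_mul]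
  have hMV : M * Vh = Uh * Matrix.diagonal σ := by
    rw [hMeq, Matrix.mul_assoc, hV, Matrix.mul_one]
  have hfac : (Uhᵀ * X) * (Vhᵀ * Y)ᵀ = Matrix.diagonal σ - Uhᵀ * E * Vh := by
    rw [hE, Matrix.mul_sub, Matrix.sub_mul, hUM, Matrix.mul_assoc (Matrix.diagonal σ), hV,
      Matrix.mul_one, sub_sub_cancel]
    simp only [Matrix.transpose_mul, Matrix.transpose_transpose, Matrix.mul_assoc]
  have hfac' : (Vhᵀ * Y) * (Uhᵀ * X)ᵀ = Matrix.diagonal σ - (Uhᵀ * E * Vh)ᵀ := by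
    have := congrArg Matrix.transpose hfac
    rw [Matrix.transpose_mul, Matrix.transpose_transpose, Matrix.transpose_sub,
      Matrix.diagonal_transpose] at this
    exact this
  have hX1β : frob (Uhᵀ * X) ≤ frob X := frob_proj_le Uh hU X
  have hY1β : frob (Vhᵀ * Y) ≤ frob Y := frob_proj_le Vh hV Y
  obtain ⟨hXu, hXi⟩ := core (Uhᵀ * X) (Vhᵀ * Y) _ σ Smin β hSmin hmin hfac
    (hE'.trans hd1) (hY1β.trans hY2)
  obtain ⟨hYu, hYi⟩ := core (Vhᵀ * Y) (Uhᵀ * X) _ σ Smin β hSmin hmin hfac'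
    (by rw [frob_transpose]; exact hE'.trans hd1) (hX1β.trans hX2)
  set X1 := Uhᵀ * X with hX1def
  set Y1 := Vhᵀ * Y with hY1def
  set η := 1.02 * (d * β / Smin) with hη
  have hη0 : 0 ≤ η := by positivity
  have hηS : η * Smin = 1.02 * (d * β) := by rw [hη]; field_simp
  have conv : ∀ x : ℝ, 0.99 * Smin * x ≤ β * d → x ≤ η := by
    intro x hx
    have : 0.99 * Smin * x ≤ 0.99 * Smin * η := by
      have : 0 ≤ d * β := by positivity
      nlinarith
    exact le_of_mul_le_mul_left this (by positivity)
  have hηr : η * r ≤ 0.0102 * β := by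
    have : Smin * (η * r) ≤ Smin * (0.0102 * β) := by
      have : Smin * (η * r) = 1.02 * β * (d * r) := by linear_combination (r : ℝ) * hηS
      rw [this]
      nlinarith
    exact le_of_mul_le_mul_left this hSmin
  -- initial factors
  set B := (X1⁻¹ * Matrix.diagonal σ)ᵀ with hB
  have hV0Y : frob (Vh * B - Y) ≤ η := by
    apply conv
    have e : (Vh * B - Y)ᵀ = X1⁻¹ * (Uhᵀ * E) := by
      have : Uhᵀ * E = Matrix.diagonal σ * Vhᵀ - X1 * Yᵀ := by
        rw [hE, Matrix.mul_sub, hUM, hX1def, Matrix.mul_assoc]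
      rw [this, Matrix.mul_sub, ← Matrix.mul_assoc X1⁻¹ X1, Matrix.nonsing_inv_mul _ hXu,
        Matrix.one_mul, Matrix.transpose_sub, Matrix.transpose_mul, hB,
        Matrix.transpose_transpose, Matrix.mul_assoc]
    rw [← frob_transpose, e]
    refine (hXi _ _).trans ?_
    gcongr
  have hU0X : frob (Uh * X1 - X) ≤ η := by
    apply conv
    have hEV : E * Vh = Uh * Matrix.diagonal σ - X * Y1ᵀ := by
      rw [hE, Matrix.sub_mul, hMV, hY1def, Matrix.transpose_mul, Matrix.transpose_transpose,
        Matrix.mul_assoc]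
    have e1 : E * Vh - Uh * (Uhᵀ * (E * Vh)) = (Uh * X1 - X) * Y1ᵀ := by
      rw [hEV, Matrix.mul_sub, ← Matrix.mul_assoc Uhᵀ Uh, hU, Matrix.one_mul, Matrix.mul_sub,
        Matrix.sub_mul, hX1def]
      simp only [Matrix.mul_assoc]
      abel
    have e2 : (Uh * X1 - X)ᵀ = Y1⁻¹ * (E * Vh - Uh * (Uhᵀ * (E * Vh)))ᵀ := by
      rw [e1, Matrix.transpose_mul (Uh * X1 - X), Matrix.transpose_transpose,
        ← Matrix.mul_assoc Y1⁻¹, Matrix.nonsing_inv_mul _ hYu, Matrix.one_mul]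
    have e3 : frob (E * Vh) ≤ d := by
      have h1 := frob_proj_le Vh hV Eᵀ
      rw [← frob_transpose, Matrix.transpose_mul, Matrix.transpose_transpose,
        Matrix.transpose_transpose, frob_transpose] at h1
      exact h1
    rw [← frob_transpose, e2]
    refine (hYi _ _).trans ?_
    rw [frob_transpose]
    gcongr
    exact (frob_coproj_le Uh hU _).trans e3
  have hUV : Uh * X1 * (Vh * B)ᵀ = M := by
    rw [Matrix.transpose_mul, hB, Matrix.transpose_transpose, hMeq]
    simp only [Matrix.mul_assoc]
    rw [← Matrix.mul_assoc X1, Matrix.mul_nonsing_inv _ hXu, Matrix.one_mul]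
  have hMW : ∀ W : Matrix (Fin n) (Fin r) ℝ, frob (Uh * X1 * (Vh * B)ᵀ * W) ≤ Smax * frob W := by
    intro W
    rw [hUV, hMeq, Matrix.mul_assoc, Matrix.mul_assoc, frob_iso Uh hU]
    refine (frob_diag_le σ Smax hσ0 hmax hSmax.le _).trans ?_
    gcongr
    exact frob_proj_le Vh hV W
  have hV1 : frob Y - η ≤ frob (Vh * B) := by
    have := frob_add_le (Vh * B) (Y - Vh * B)
    rw [add_sub_cancel, frob_sub_comm Y] at this
    linarith
  have hV2 : frob (Vh * B) ≤ frob Y + η := by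
    have := frob_add_le Y (Vh * B - Y)
    rw [add_sub_cancel] at this
    linarith
  obtain ⟨N, N', hN, hNU, hNV, hdU, hdV⟩ := adjust hr (Uh * X1) (Vh * B) Smax β η (frob X)
    (frob Y) hSmax hβ hβ2 hη0 hηr hMW hXa (by rw [frob_iso Uh hU]; exact hX1β) hYb hY2 hV1 hV2
  refine ⟨Uh * X1 * N, Vh * B * N', ?_, hNU, hNV, ?_, ?_, ?_⟩
  · rw [Matrix.transpose_mul, Matrix.mul_assoc, ← Matrix.mul_assoc N, hN, Matrix.one_mul, hUV]
  · have hq1 : 1 ≤ Real.sqrt r := Real.one_le_sqrt.2 hr'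
    have h1 : frob (Uh * X1 * N - X) ≤ 1.1 * η := by
      have := frob_add_le (Uh * X1 * N - Uh * X1) (Uh * X1 - X)
      rw [sub_add_sub_cancel] at this
      linarith
    have h2 : frob (Vh * B * N' - Y) ≤ 3.1 * Real.sqrt r * η := by
      have := frob_add_le (Vh * B * N' - Vh * B) (Vh * B - Y)
      rw [sub_add_sub_cancel] at this
      have h3 : 1 * η ≤ Real.sqrt r * η := mul_le_mul_of_nonneg_right hq1 hη0
      linarith
    calc _ ≤ 1.1 * η * (3.1 * Real.sqrt r * η) := by
          apply mul_le_mul h1 h2 (frob_nonneg _) (by positivity)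
      _ = (1.1 * 3.1 * 1.02 ^ 2) * (Real.sqrt r * (β ^ 2 / Smin ^ 2) * d ^ 2) := by
          rw [hη]; field_simp
      _ ≤ 25 * (Real.sqrt r * (β ^ 2 / Smin ^ 2) * d ^ 2) := by
          gcongr; norm_num
      _ = _ := by ring
  · intro i
    have h1 := rowNorm_mul_sq Uh (X1 * N) i
    rw [Matrix.mul_assoc]
    rw [Matrix.mul_assoc, frob_iso Uh hU] at hNU
    have h2 : 0 ≤ ∑ k, Uh i k ^ 2 := by positivity
    have h3 := frob_nonneg (X1 * N)
    refine h1.trans ?_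
    rw [mul_comm (r : ℝ) μ]
    have := hμU i
    have h4 := hNU.trans hX2
    have h5 := h2.trans this
    gcongr
  · intro i
    have h1 := rowNorm_mul_sq Vh (B * N') i
    rw [Matrix.mul_assoc]
    rw [Matrix.mul_assoc, frob_iso Vh hV] at hNV
    have h2 : 0 ≤ ∑ k, Vh i k ^ 2 := by positivity
    have h3 := frob_nonneg (B * N')
    refine h1.trans ?_
    rw [mul_comm (r : ℝ) μ]
    have := hμV i
    have h4 := hNV.trans hY2
    have h5 := h2.trans this
    gcongr

end
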